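/- Let f be a homeomorphism of the torus T² homotopic to a Dehn twist, with lift f̂ to the vertical cylinder A. If 0 ∈ ρ_V(f̂), then both B⁻ and B⁺ have at least one unbounded connected component; that is, the sets B_S⁻ and B_N⁺ are nonempty. -/

import Mathlib

noncomputable section

open MeasureTheory

abbrev Torus := AddCircle (1 : ℝ) × AddCircle (1 : ℝ)
abbrev Cyl := AddCircle (1 : ℝ) × ℝ

/-- The covering map from the plane to the vertical cylinder. -/
def projCyl (z : ℝ × ℝ) : Cyl := ((z.1 : AddCircle (1 : ℝ)), z.2)

/-- The covering map from the plane to the torus. -/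
def projTorus (z : ℝ × ℝ) : Torus := ((z.1 : AddCircle (1 : ℝ)), (z.2 : AddCircle (1 : ℝ)))

/-- A lift to the plane of a torus homeomorphism homotopic to a Dehn twist:
a homeomorphism of the plane commuting with integer horizontal translations and
satisfying the Dehn-twist relation for vertical translations, with twist
coefficient `k > 0`. -/
structure DehnLift where
  F : (ℝ × ℝ) ≃ₜ (ℝ × ℝ)
  k : ℤ
  k_pos : 0 < k
  horiz : ∀ x y : ℝ, F (x + 1, y) = F (x, y) + (1, 0)
  vert : ∀ x y : ℝ, F (x, y + 1) = F (x, y) + ((k : ℝ), 1)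

/-- The vertical rotation set of a cylinder map:
`ρ_V(f̂) = ∩_{i≥1} closure( ∪_{n≥i} { (p₂(f̂ⁿ(ẑ)) − p₂(ẑ))/n : ẑ ∈ A } )`. -/
def rotSet (fhat : Cyl → Cyl) : Set ℝ :=
  ⋂ i : ℕ, closure (⋃ n : ℕ, ⋃ _ : i + 1 ≤ n,
    {r : ℝ | ∃ z : Cyl, r = ((fhat^[n] z).2 - z.2) / n})

/-- A subset of the cylinder is bounded iff its second-coordinate projection is
a bounded subset of `ℝ`. -/
def VBounded (S : Set Cyl) : Prop := ∃ M : ℝ, ∀ z ∈ S, |z.2| ≤ M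

/-- `B⁻ = {ẑ : f̂ⁿ(ẑ) ∈ H⁻ for all n ≥ 0}` where `H⁻ = (ℝ/ℤ)×(−∞,0]`. -/
def Bminus (fhat : Cyl → Cyl) : Set Cyl := {z | ∀ n : ℕ, (fhat^[n] z).2 ≤ 0}

/-- `B⁺ = {ẑ : f̂ⁿ(ẑ) ∈ H⁺ for all n ≥ 0}` where `H⁺ = (ℝ/ℤ)×[0,∞)`. -/
def Bplus (fhat : Cyl → Cyl) : Set Cyl := {z | ∀ n : ℕ, 0 ≤ (fhat^[n] z).2}

/-- `B_S⁻`: the union of the unbounded connected components of `B⁻`. -/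
def BS (fhat : Cyl → Cyl) : Set Cyl :=
  {z | z ∈ Bminus fhat ∧ ¬ VBounded (connectedComponentIn (Bminus fhat) z)}

/-- `B_N⁺`: the union of the unbounded connected components of `B⁺`. -/
def BN (fhat : Cyl → Cyl) : Set Cyl :=
  {z | z ∈ Bplus fhat ∧ ¬ VBounded (connectedComponentIn (Bplus fhat) z)}

/-- The ω-limit set `ω(S) = ∩_{n≥0} closure(∪_{i≥n} f̂ⁱ(S))`. -/
def omegaSet (fhat : Cyl → Cyl) (S : Set Cyl) : Set Cyl :=
  ⋂ n : ℕ, closure (⋃ i : ℕ, ⋃ _ : n ≤ i, fhat^[i] '' S)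

open Set Topology Filter

theorem preconn_iInter {α : Type*} [TopologicalSpace α] [T2Space α] [CompactSpace α]
    (P : ℕ → Set α) (hP : Antitone P) (hc : ∀ n, IsClosed (P n))
    (hp : ∀ n, IsPreconnected (P n)) : IsPreconnected (⋂ n, P n) := by
  rw [isPreconnected_iff_subset_of_fully_disjoint_closed (isClosed_iInter hc)]
  intro u v hu hv hs huv
  obtain ⟨U, V, hU, hV, huU, hvV, hUV⟩ := normal_separation hu hv huv
  obtain ⟨n, hn⟩ := exists_subset_nhds_of_isCompact (V := P) (U := U ∪ V) hP.directed_ge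
    (fun i => (hc i).isCompact)
    (fun x hx => (hU.union hV).mem_nhds (union_subset_union huU hvV (hs hx)))
  have hsub := iInter_subset P n
  rcases (hp n).subset_or_subset hU hV hUV hn with h | h
  · left
    intro x hx
    rcases hs hx with h1 | h1
    · exact h1
    · exact (disjoint_left.1 hUV (h (hsub hx)) (hvV h1)).elim
  · right
    intro x hx
    rcases hs hx with h1 | h1
    · exact (disjoint_left.1 hUV (huU h1) (h (hsub hx))).elim
    · exact h1

theorem bumping {α : Type*} [TopologicalSpace α] [T2Space α] [CompactSpace α]
    {X E D : Set α} (hX : IsPreconnected X) (hXc : IsClosed X) (hE : IsClosed E)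
    (hD : IsClosed D) (hXED : X ⊆ E ∪ D) {z : α} (hz : z ∈ X ∩ E) :
    X ⊆ E ∨ (connectedComponentIn (X ∩ E) z ∩ D).Nonempty := by
  by_contra! hcon
  obtain ⟨hnot, hemp⟩ := hcon
  have hcl : IsClosed (X ∩ E) := hXc.inter hE
  have hcpt : CompactSpace (X ∩ E : Set α) := isCompact_iff_compactSpace.1 hcl.isCompact
  rw [connectedComponentIn_eq_image hz, connectedComponent_eq_iInter_isClopen] at hemp
  have key : ∃ s : Set (X ∩ E : Set α), IsClopen s ∧ (⟨z, hz⟩ : (X ∩ E : Set α)) ∈ s ∧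
      s ⊆ (Subtype.val ⁻¹' Dᶜ) := by
    have : Nonempty { s : Set (X ∩ E : Set α) // IsClopen s ∧ (⟨z, hz⟩ : (X ∩ E : Set α)) ∈ s } :=
      ⟨⟨univ, isClopen_univ, mem_univ _⟩⟩
    obtain ⟨s, hs⟩ := exists_subset_nhds_of_isCompact
      (V := fun s : { s : Set (X ∩ E : Set α) // IsClopen s ∧ (⟨z, hz⟩ : (X ∩ E : Set α)) ∈ s } => s.1)
      (U := Subtype.val ⁻¹' Dᶜ)
      (by
        intro a b
        exact ⟨⟨a.1 ∩ b.1, a.2.1.inter b.2.1, a.2.2, b.2.2⟩, inter_subset_left, inter_subset_right⟩)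
      (fun s => s.2.1.isClosed.isCompact)
      (by
        intro x hx
        refine (hD.isOpen_compl.preimage continuous_subtype_val).mem_nhds ?_
        intro hxD
        have : (x : α) ∈ (∅ : Set α) := hemp ▸ ⟨⟨x, hx, rfl⟩, hxD⟩
        exact this)
    exact ⟨s.1, s.2.1, s.2.2, hs⟩
  obtain ⟨s, hs, hzs, hsD⟩ := key
  have c1 : IsClosed (Subtype.val '' s : Set α) := hcl.isClosedEmbedding_subtypeVal.isClosedMap _ hs.isClosed
  have c2 : IsClosed (Subtype.val '' sᶜ : Set α) :=
    hcl.isClosedEmbedding_subtypeVal.isClosedMap _ hs.compl.isClosed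
  rw [isPreconnected_iff_subset_of_disjoint_closed] at hX
  rcases hX _ _ c1 (c2.union hD) (by
      intro x hx
      by_cases hxE : x ∈ E
      · by_cases hxs : (⟨x, hx, hxE⟩ : (X ∩ E : Set α)) ∈ s
        · exact Or.inl ⟨_, hxs, rfl⟩
        · exact Or.inr (Or.inl ⟨_, hxs, rfl⟩)
      · exact Or.inr (Or.inr ((hXED hx).resolve_left hxE))) (by
      rw [eq_empty_iff_forall_notMem]
      rintro x ⟨_, ⟨a, ha, rfl⟩, h | h⟩
      · obtain ⟨b, hb, hab⟩ := h
        exact hb (Subtype.ext hab ▸ ha)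
      · exact hsD ha h) with h | h
  · apply hnot
    intro x hx
    obtain ⟨a, _, rfl⟩ := h hx
    exact a.2.2
  · rcases h hz.1 with ⟨b, hb, hbz⟩ | h
    · exact hb ((Subtype.ext hbz : b = ⟨z, hz⟩) ▸ hzs)
    · exact hsD hzs h

/-- Half-cylinder together with infinity. -/
def Half (c : ℝ) : Set (OnePoint Cyl) := ((↑) '' {z : Cyl | c < z.2})ᶜ

theorem half_closed (c : ℝ) : IsClosed (Half c) := by
  rw [Half, isClosed_compl_iff, OnePoint.isOpen_image_coe]
  exact isOpen_lt continuous_const continuous_snd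

theorem mem_half_coe (c : ℝ) (z : Cyl) : (z : OnePoint Cyl) ∈ Half c ↔ z.2 ≤ c := by
  simp [Half]

theorem infty_mem_half (c : ℝ) : (OnePoint.infty : OnePoint Cyl) ∈ Half c := by
  simp [Half]

theorem band_compact (a b : ℝ) : IsCompact {z : Cyl | a ≤ z.2 ∧ z.2 ≤ b} := by
  have : {z : Cyl | a ≤ z.2 ∧ z.2 ≤ b} = univ ×ˢ Icc a b := by ext; simp
  rw [this]
  exact isCompact_univ.prod isCompact_Icc

theorem band_closed (a b : ℝ) :
    IsClosed ((↑) '' {z : Cyl | a ≤ z.2 ∧ z.2 ≤ b} : Set (OnePoint Cyl)) :=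
  ((band_compact a b).image OnePoint.continuous_coe).isClosed

theorem half_preconn (c : ℝ) : IsPreconnected (Half c) := by
  have h1 : IsPreconnected {z : Cyl | z.2 ≤ c} := by
    have : {z : Cyl | z.2 ≤ c} = univ ×ˢ Iic c := by ext; simp
    rw [this]
    exact isPreconnected_univ.prod isPreconnected_Iic
  have h2 := h1.image ((↑) : Cyl → OnePoint Cyl) OnePoint.continuous_coe.continuousOn
  refine h2.subset_closure ?_ ?_
  · rintro _ ⟨z, hz, rfl⟩
    exact (mem_half_coe c z).2 hz
  · intro x hx
    induction x using OnePoint.rec with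
    | coe z => exact subset_closure ⟨z, (mem_half_coe c z).1 hx, rfl⟩
    | infty =>
      by_contra hcon
      have hcl : IsClosed ((↑) '' {z : Cyl | z.2 ≤ c} : Set (OnePoint Cyl)) := by
        refine isClosed_of_closure_subset ?_
        intro x hx
        induction x using OnePoint.rec with
        | infty => exact (hcon hx).elim
        | coe z =>
          have := closure_minimal (s := ((↑) '' {z : Cyl | z.2 ≤ c} : Set (OnePoint Cyl)))
            (t := Half c) (by rintro _ ⟨z, hz, rfl⟩; exact (mem_half_coe c z).2 hz)
            (half_closed c) hx
          exact ⟨z, (mem_half_coe c z).1 this, rfl⟩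
      have hcp := (OnePoint.isClosed_image_coe.1 hcl).2
      obtain ⟨M, hM⟩ := (hcp.image continuous_snd).bddBelow
      have := hM ⟨((0 : AddCircle (1:ℝ)), min c (M - 1)),
        (show min c (M - 1) ≤ c from min_le_left _ _), rfl⟩
      simp only at this
      have h3 := min_le_right c (M - 1)
      linarith

section main
variable (φ : Cyl ≃ₜ Cyl)

/-- Points whose first iterates remain in the lower half. -/
def KK (n : ℕ) : Set (OnePoint Cyl) := {x | ∀ i ≤ n, (φ.onePointCongr)^[i] x ∈ Half 0}

/-- Component of infinity. -/
def PP (n : ℕ) : Set (OnePoint Cyl) := connectedComponentIn (KK φ n) OnePoint.infty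

theorem ext_infty : φ.onePointCongr OnePoint.infty = OnePoint.infty := rfl

theorem ext_coe (z : Cyl) : φ.onePointCongr (z : OnePoint Cyl) = (φ z : Cyl) := rfl

theorem ext_iter_infty (n : ℕ) : (φ.onePointCongr)^[n] OnePoint.infty = OnePoint.infty :=
  Function.iterate_fixed (ext_infty φ) n

theorem ext_iter_coe (n : ℕ) (z : Cyl) :
    (φ.onePointCongr)^[n] (z : OnePoint Cyl) = (φ^[n] z : Cyl) := by
  induction n generalizing z with
  | zero => rfl
  | succ n ih => rw [Function.iterate_succ_apply, ext_coe, ih, Function.iterate_succ_apply]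

theorem infty_mem_KK (n : ℕ) : OnePoint.infty ∈ KK φ n := by
  intro i _
  rw [ext_iter_infty]
  exact infty_mem_half 0

theorem infty_mem_PP (n : ℕ) : OnePoint.infty ∈ PP φ n :=
  mem_connectedComponentIn (infty_mem_KK φ n)

theorem KK_closed (n : ℕ) : IsClosed (KK φ n) := by
  have : KK φ n = ⋂ i, ⋂ _ : i ≤ n, (φ.onePointCongr)^[i] ⁻¹' Half 0 := by
    ext x; simp [KK]
  rw [this]
  exact isClosed_iInter fun i => isClosed_iInter fun _ =>
    (half_closed 0).preimage (φ.onePointCongr.continuous.iterate i)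

theorem PP_preconn (n : ℕ) : IsPreconnected (PP φ n) := isPreconnected_connectedComponentIn

theorem PP_sub (n : ℕ) : PP φ n ⊆ KK φ n := connectedComponentIn_subset _ _

theorem PP_closed (n : ℕ) : IsClosed (PP φ n) := by
  refine isClosed_of_closure_subset ?_
  refine (PP_preconn φ n).closure.subset_connectedComponentIn
    (subset_closure (infty_mem_PP φ n)) ?_
  exact closure_minimal (PP_sub φ n) (KK_closed φ n)

theorem PP_anti : Antitone (PP φ) := by
  intro a b hab
  exact connectedComponentIn_mono _ fun x hx i hi => hx i (hi.trans hab)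

theorem case_one {x : OnePoint Cyl} (hx : x ∈ ⋂ n, PP φ n) (hne : x ≠ OnePoint.infty) :
    (BS φ).Nonempty := by
  obtain ⟨z, rfl⟩ := OnePoint.ne_infty_iff_exists.1 hne
  have hB : ∀ w : Cyl, (w : OnePoint Cyl) ∈ ⋂ n, PP φ n → w ∈ Bminus φ := by
    intro w hw n
    have := PP_sub φ n (mem_iInter.1 hw n) n le_rfl
    rw [ext_iter_coe, mem_half_coe] at this
    exact this
  refine ⟨z, hB z hx, ?_⟩
  rintro ⟨M, hM⟩
  set N : ℝ := min (-M - 1) z.2 with hN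
  have hz0 : z.2 ≤ 0 := hB z hx 0
  have hNz : N ≤ z.2 := min_le_right _ _
  have hNM : N ≤ -M - 1 := min_le_left _ _
  have hXhalf : (⋂ n, PP φ n) ⊆ Half 0 := fun y hy =>
    PP_sub φ 0 (mem_iInter.1 hy 0) 0 le_rfl
  rcases bumping (preconn_iInter _ (PP_anti φ) (PP_closed φ) (PP_preconn φ))
    (isClosed_iInter (PP_closed φ)) (band_closed N 0) (half_closed N)
    (by
      intro y hy
      induction y using OnePoint.rec with
      | infty => exact Or.inr (infty_mem_half _)
      | coe y =>
        rcases le_total N y.2 with h | h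
        · exact Or.inl ⟨y, ⟨h, (mem_half_coe _ _).1 (hXhalf hy)⟩, rfl⟩
        · exact Or.inr ((mem_half_coe _ _).2 h))
    (z := (z : OnePoint Cyl)) ⟨hx, z, ⟨hNz, hz0⟩, rfl⟩ with h | h
  · obtain ⟨y, _, hy⟩ := h (mem_iInter.2 (infty_mem_PP φ))
    exact OnePoint.coe_ne_infty y hy
  · obtain ⟨y, hyC, hyD⟩ := h
    set C := connectedComponentIn ((⋂ n, PP φ n) ∩
      ((↑) '' {z : Cyl | N ≤ z.2 ∧ z.2 ≤ 0} : Set (OnePoint Cyl))) (z : OnePoint Cyl) with hC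
    have hCs := connectedComponentIn_subset ((⋂ n, PP φ n) ∩
      ((↑) '' {z : Cyl | N ≤ z.2 ∧ z.2 ≤ 0} : Set (OnePoint Cyl))) (z : OnePoint Cyl)
    rw [← hC] at hCs
    have hCp : IsPreconnected C := isPreconnected_connectedComponentIn
    have hCpre : IsPreconnected (((↑) : Cyl → OnePoint Cyl) ⁻¹' C) :=
      hCp.preimage_of_isOpenMap OnePoint.coe_injective OnePoint.isOpenMap_coe
        (fun w hw => by
          obtain ⟨y, _, hy⟩ := (hCs hw).2
          exact ⟨y, hy⟩)
    have hsub := hCpre.subset_connectedComponentIn (x := z) (F := Bminus φ)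
      (mem_connectedComponentIn ⟨hx, z, ⟨hNz, hz0⟩, rfl⟩)
      (fun w hw => hB w (hCs hw).1)
    obtain ⟨y, _, rfl⟩ := (hCs hyC).2
    have h1 := hM y (hsub hyC)
    have h2 := (mem_half_coe _ _).1 hyD
    have h3 := (abs_le.1 h1).1
    linarith

theorem small (hB : ∀ x ∈ ⋂ n, PP φ n, x = OnePoint.infty) (c : ℝ) :
    ∃ n, ∀ z : Cyl, (z : OnePoint Cyl) ∈ PP φ n → z.2 < c := by
  obtain ⟨n, hn⟩ := exists_subset_nhds_of_isCompact (V := PP φ)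
    (U := ((↑) '' {z : Cyl | c ≤ z.2 ∧ z.2 ≤ 0} : Set (OnePoint Cyl))ᶜ) (PP_anti φ).directed_ge
    (fun i => (PP_closed φ i).isCompact)
    (fun x hx => by
      rw [hB x hx]
      refine (band_closed c 0).isOpen_compl.mem_nhds ?_
      rintro ⟨y, _, hy⟩
      exact OnePoint.coe_ne_infty y hy)
  refine ⟨n, fun z hz => ?_⟩
  by_contra! hcon
  have h0 := PP_sub φ n hz 0 (Nat.zero_le _)
  exact hn hz ⟨z, ⟨hcon, (mem_half_coe _ _).1 h0⟩, rfl⟩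

theorem step {M : ℝ} (hM : ∀ z : Cyl, |(φ z).2 - z.2| ≤ M) (n : ℕ)
    (hn : ∀ z : Cyl, (z : OnePoint Cyl) ∈ PP φ (n + 1) → z.2 < 0)
    (x : OnePoint Cyl) (hx : φ.onePointCongr x ∈ PP φ n) : x ∈ PP φ (n + 1) := by
  have hK : (φ.onePointCongr ⁻¹' PP φ n) ∩ Half 0 ⊆ KK φ (n + 1) := by
    rintro y ⟨hy, hy0⟩ i hi
    cases i with
    | zero => exact hy0
    | succ i => 
      rw [Function.iterate_succ_apply]
      exact PP_sub φ n hy i (by omega)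
  have hpre : IsPreconnected (φ.onePointCongr ⁻¹' PP φ n) := by
    rw [φ.onePointCongr.isPreconnected_preimage]
    exact PP_preconn φ n
  have hinf : OnePoint.infty ∈ φ.onePointCongr ⁻¹' PP φ n := by
    rw [mem_preimage, ext_infty]; exact infty_mem_PP φ n
  rcases bumping hpre ((PP_closed φ n).preimage φ.onePointCongr.continuous) (half_closed 0)
    (band_closed 0 M)
    (by
      intro y hy
      induction y using OnePoint.rec with
      | infty => exact Or.inl (infty_mem_half _)
      | coe y =>
        rcases le_total 0 y.2 with h | h
        · refine Or.inr ⟨y, ⟨h, ?_⟩, rfl⟩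
          have h1 := PP_sub φ n hy 0 (Nat.zero_le _)
          rw [Function.iterate_zero, id, ext_coe, mem_half_coe] at h1
          have h2 := (abs_le.1 (hM y)).1
          linarith
        · exact Or.inl ((mem_half_coe _ _).2 h))
    (z := OnePoint.infty) ⟨hinf, infty_mem_half 0⟩ with h | h
  · exact hpre.subset_connectedComponentIn hinf (fun y hy => hK ⟨hy, h hy⟩) hx
  · obtain ⟨y, hyC, w, hw, rfl⟩ := h
    have := hn w (connectedComponentIn_mono _ hK hyC)
    exact absurd hw.1 (not_le.2 this)

theorem iter_disp {M : ℝ} (hM : ∀ z : Cyl, |(φ z).2 - z.2| ≤ M) (n : ℕ) (z : Cyl) :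
    |(φ^[n] z).2 - z.2| ≤ n * M := by
  induction n with
  | zero => simp
  | succ n ih =>
    rw [Function.iterate_succ_apply']
    have h1 := hM (φ^[n] z)
    push_cast
    rw [abs_le] at *
    constructor <;> linarith [h1.1, h1.2, ih.1, ih.2]

theorem iter_comm (hT : ∀ z : Cyl, φ (z + (0, 1)) = φ z + (0, 1)) (n : ℕ) (j : ℤ) (z : Cyl) :
    φ^[n] (z + (0, (j : ℝ))) = φ^[n] z + (0, (j : ℝ)) := by
  have h1 : ∀ j : ℤ, ∀ z : Cyl, φ (z + (0, (j : ℝ))) = φ z + (0, (j : ℝ)) := by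
    intro j
    induction j with
    | zero => intro z; simp [← Prod.zero_eq_mk]
    | succ i ih =>
      intro z
      have := hT (z + (0, ((i : ℤ) : ℝ)))
      rw [ih, add_assoc, add_assoc] at this
      simpa using this
    | pred i ih =>
      intro z
      have := hT (z + (0, ((-(i : ℤ) - 1 : ℤ) : ℝ)))
      rw [add_assoc] at this
      have e : ((0, ((-(i : ℤ) - 1 : ℤ) : ℝ)) : Cyl) + (0, 1) = (0, ((-(i:ℤ) : ℤ) : ℝ)) := by
        simp
      rw [e, ih, ← e, ← add_assoc] at this
      exact (add_right_cancel this).symm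
  induction n generalizing z with
  | zero => rfl
  | succ n ih => rw [Function.iterate_succ_apply, h1, ih, Function.iterate_succ_apply]

theorem core {M : ℝ} (hM : ∀ z : Cyl, |(φ z).2 - z.2| ≤ M)
    (hT : ∀ z : Cyl, φ (z + (0, 1)) = φ z + (0, 1))
    (hzero : (0:ℝ) ∈ rotSet φ) : (BS φ).Nonempty := by
  by_cases hB : ∀ x ∈ ⋂ n, PP φ n, x = OnePoint.infty
  swap
  · push Not at hB
    obtain ⟨x, hx, hne⟩ := hB
    exact case_one φ hx hne
  exfalso
  have hM0 : 0 ≤ M := (abs_nonneg _).trans (hM 0)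
  obtain ⟨n₀, hn₀⟩ := small φ hB 0
  have hstep : ∀ n, n₀ ≤ n → ∀ x, φ.onePointCongr x ∈ PP φ n → x ∈ PP φ (n + 1) := by
    intro n hn
    exact step φ hM n (fun z hz => hn₀ z (PP_anti φ (by omega) hz))
  have hsteps : ∀ m, ∀ x, (φ.onePointCongr)^[m] x ∈ PP φ n₀ → x ∈ PP φ (n₀ + m) := by
    intro m
    induction m with
    | zero => intro x hx; exact hx
    | succ m ih =>
      intro x hx
      rw [Function.iterate_succ_apply] at hx
      exact hstep (n₀ + m) (by omega) x (ih _ hx)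
  set L : ℝ := n₀ * M with hL
  have hnb : Half (-L) ⊆ PP φ n₀ := by
    refine (half_preconn (-L)).subset_connectedComponentIn (infty_mem_half _) ?_
    intro x hx i hi
    induction x using OnePoint.rec with
    | infty => rw [ext_iter_infty]; exact infty_mem_half 0
    | coe z =>
      rw [ext_iter_coe, mem_half_coe]
      rw [mem_half_coe] at hx
      have h1 := (abs_le.1 (iter_disp φ hM i z)).2
      have h2 : (i : ℝ) * M ≤ n₀ * M := by gcongr
      linarith
  obtain ⟨m₀, hm₀⟩ := small φ hB (-L - 1)
  set m := m₀ + 1 with hm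
  have hmove : ∀ z : Cyl, (φ^[m] z).2 ≤ -L → z.2 ≤ -L - 1 := by
    intro z hz
    refine (hm₀ z (PP_anti φ (by omega : m₀ ≤ n₀ + m) (hsteps m _ (hnb ?_)))).le
    rw [ext_iter_coe, mem_half_coe]
    exact hz
  have hmove2 : ∀ (j : ℤ) (z : Cyl), (φ^[m] z).2 ≤ -L + j → z.2 ≤ -L + j - 1 := by
    intro j z hz
    have h1 := hmove (z + (0, ((-j : ℤ) : ℝ))) (by
      rw [iter_comm φ hT]
      simp only [Prod.snd_add]; push_cast; linarith)
    simp only [Prod.snd_add] at h1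
    push_cast at h1
    linarith
  have hmove3 : ∀ (k : ℕ) (j : ℤ) (z : Cyl), (φ^[m * k] z).2 ≤ -L + j → z.2 ≤ -L + j - k := by
    intro k
    induction k with
    | zero => intro j z hz; simpa using hz
    | succ k ih =>
      intro j z hz
      rw [Nat.mul_succ, Function.iterate_add_apply] at hz
      have h1 := ih j _ hz
      have h2 := hmove2 (j - k) z (by push_cast; linarith)
      push_cast at h2 ⊢
      linarith
  have hmove4 : ∀ (k : ℕ) (z : Cyl), z.2 + k - 1 ≤ (φ^[m * k] z).2 := by
    intro k z
    have h1 := hmove3 k ⌈(φ^[m * k] z).2 + L⌉ z (by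
      have := Int.le_ceil ((φ^[m * k] z).2 + L); linarith)
    have h2 := Int.ceil_lt_add_one ((φ^[m * k] z).2 + L)
    linarith
  have hmpos : (0 : ℝ) < m := by rw [hm]; positivity
  have hfin : ∀ (N : ℕ) (z : Cyl), (N : ℝ) / m - (2 + m * M) ≤ (φ^[N] z).2 - z.2 := by
    intro N z
    have e := Nat.mod_add_div N m
    have h1 := hmove4 (N / m) z
    have h2 := (abs_le.1 (iter_disp φ hM (N % m) (φ^[m * (N / m)] z))).1
    rw [← Function.iterate_add_apply, e] at h2
    have h3 : (N % m : ℕ) < m := Nat.mod_lt _ (by omega)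
    have h4 : ((N % m : ℕ) : ℝ) * M ≤ m * M := by gcongr
    have h5 : (N : ℝ) / m ≤ (N / m : ℕ) + 1 := by
      rw [div_le_iff₀ hmpos]
      have : N ≤ (N / m + 1) * m := by rw [add_mul, mul_comm]; omega
      exact_mod_cast this
    linarith
  obtain ⟨i, hi⟩ := exists_nat_ge (2 * m * (2 + m * M))
  have h0 := mem_iInter.1 hzero i
  have hsub : closure (⋃ n : ℕ, ⋃ _ : i + 1 ≤ n,
      {r : ℝ | ∃ z : Cyl, r = ((φ^[n] z).2 - z.2) / n}) ⊆ Ici (1 / (2 * m : ℝ)) := by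
    refine closure_minimal ?_ isClosed_Ici
    intro r hr
    simp only [mem_iUnion] at hr
    obtain ⟨N, hN, z, rfl⟩ := hr
    have hN' : ((i : ℝ) + 1) ≤ N := by exact_mod_cast hN
    have hNpos : (0 : ℝ) < N := by have : (0:ℝ) ≤ i := Nat.cast_nonneg i; linarith
    rw [mem_Ici, le_div_iff₀ hNpos]
    refine le_trans ?_ (hfin N z)
    have : (2 + m * M) ≤ 1 / (2 * m) * (N : ℝ) := by
      rw [div_mul_eq_mul_div, one_mul, le_div_iff₀ (by positivity)]
      linarith
    have e : (N : ℝ) / m = 2 * (1 / (2 * m) * (N : ℝ)) := by field_simp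
    linarith
  have := hsub h0
  rw [mem_Ici] at this
  have h7 : (0:ℝ) < 1 / (2 * m : ℝ) := by positivity
  linarith

end main

theorem projCyl_surj : Function.Surjective projCyl := by
  rintro ⟨x, y⟩
  obtain ⟨x, rfl⟩ := QuotientAddGroup.mk_surjective x
  exact ⟨(x, y), rfl⟩

theorem projCyl_quot : IsOpenQuotientMap projCyl :=
  (QuotientAddGroup.isOpenQuotientMap_mk (N := AddSubgroup.zmultiples (1:ℝ))).prodMap
    (IsOpenQuotientMap.id (X := ℝ))

theorem projCyl_eq {z w : ℝ × ℝ} (h : projCyl z = projCyl w) : ∃ n : ℤ, w = z + ((n : ℝ), 0) := by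
  obtain ⟨a, b⟩ := z
  obtain ⟨c, d⟩ := w
  simp only [projCyl, Prod.mk.injEq] at h
  obtain ⟨h1, h2⟩ := h
  rw [QuotientAddGroup.eq, AddSubgroup.mem_zmultiples_iff] at h1
  obtain ⟨n, hn⟩ := h1
  refine ⟨n, ?_⟩
  simp at hn
  ext
  · simp; linarith
  · simp [h2]

theorem projCyl_add_int (z : ℝ × ℝ) (n : ℤ) (t : ℝ) :
    projCyl (z + ((n : ℝ), t)) = projCyl z + (0, t) := by
  have : (((n : ℝ)) : AddCircle (1:ℝ)) = 0 := by
    rw [AddCircle.coe_eq_zero_iff]; exact ⟨n, by simp⟩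
  simp [projCyl, this]

theorem horiz_int (G : ℝ × ℝ → ℝ × ℝ) (h : ∀ z, G (z + (1, 0)) = G z + (1, 0)) (n : ℤ) :
    ∀ z, G (z + ((n : ℝ), 0)) = G z + ((n : ℝ), 0) := by
  induction n with
  | zero => intro z; simp [← Prod.zero_eq_mk]
  | succ i ih =>
    intro z
    have := h (z + (((i : ℤ) : ℝ), 0))
    rw [ih, add_assoc, add_assoc] at this
    simpa using this
  | pred i ih =>
    intro z
    have := h (z + (((-(i : ℤ) - 1 : ℤ) : ℝ), 0))
    rw [add_assoc] at this
    have e : ((((-(i : ℤ) - 1 : ℤ) : ℝ), 0) : ℝ × ℝ) + (1, 0) = (((-(i:ℤ) : ℤ) : ℝ), 0) := by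
      simp
    rw [e, ih, ← e, ← add_assoc] at this
    exact (add_right_cancel this).symm

theorem exists_homeo (L : DehnLift) (fhat : Cyl → Cyl)
    (hfhat : ∀ z : ℝ × ℝ, projCyl (L.F z) = fhat (projCyl z)) :
    ∃ φ : Cyl ≃ₜ Cyl, ⇑φ = fhat := by
  have hF : ∀ z, L.F (z + (1, 0)) = L.F z + (1, 0) := by
    rintro ⟨x, y⟩; simpa using L.horiz x y
  have hG : ∀ z, L.F.symm (z + (1, 0)) = L.F.symm z + (1, 0) := by
    intro z
    apply L.F.injective
    rw [hF]; simp
  have hinv : ∀ z w, projCyl z = projCyl w → projCyl (L.F.symm z) = projCyl (L.F.symm w) := by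
    intro z w h
    obtain ⟨n, rfl⟩ := projCyl_eq h
    rw [horiz_int _ hG, projCyl_add_int]
    simp [← Prod.zero_eq_mk]
  choose s hs using projCyl_surj
  have hg : ∀ z, projCyl (L.F.symm (s (projCyl z))) = projCyl (L.F.symm z) :=
    fun z => hinv _ _ (hs _)
  refine ⟨{ toFun := fhat, invFun := fun z => projCyl (L.F.symm (s z)), left_inv := ?_,
            right_inv := ?_, continuous_toFun := ?_, continuous_invFun := ?_ }, rfl⟩
  · intro z
    obtain ⟨z, rfl⟩ := projCyl_surj z
    simp only [← hfhat, hg]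
    simp
  · intro z
    obtain ⟨z, rfl⟩ := projCyl_surj z
    simp only [hg, ← hfhat]
    simp
  · rw [← projCyl_quot.continuous_comp_iff]
    have : fhat ∘ projCyl = projCyl ∘ L.F := by ext1 z; exact (hfhat z).symm
    rw [this]
    exact projCyl_quot.continuous.comp L.F.continuous
  · rw [← projCyl_quot.continuous_comp_iff]
    have : (fun z => projCyl (L.F.symm (s z))) ∘ projCyl = projCyl ∘ L.F.symm := by
      ext1 z; exact hg z
    rw [this]
    exact projCyl_quot.continuous.comp L.F.symm.continuous

theorem comm_T (L : DehnLift) (fhat : Cyl → Cyl)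
    (hfhat : ∀ z : ℝ × ℝ, projCyl (L.F z) = fhat (projCyl z)) (z : Cyl) :
    fhat (z + (0, 1)) = fhat z + (0, 1) := by
  obtain ⟨z, rfl⟩ := projCyl_surj z
  have h := projCyl_add_int z 0 1
  rw [← h, ← hfhat, ← hfhat, ← projCyl_add_int _ L.k]
  congr 1
  obtain ⟨x, y⟩ := z
  simpa using L.vert x y

theorem exists_bound (φ : Cyl ≃ₜ Cyl) (hT : ∀ z : Cyl, φ (z + (0, 1)) = φ z + (0, 1)) :
    ∃ M : ℝ, ∀ z : Cyl, |(φ z).2 - z.2| ≤ M := by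
  have hc : Continuous fun z : Cyl => |(φ z).2 - z.2| := by fun_prop
  obtain ⟨M, hM⟩ := ((band_compact 0 1).image hc).bddAbove
  refine ⟨M, fun z => ?_⟩
  have h1 := hM ⟨z + (0, ((-⌊z.2⌋ : ℤ) : ℝ)), ⟨?_, ?_⟩, rfl⟩
  · have h2 := iter_comm φ hT 1 (-⌊z.2⌋) z
    simp only [Function.iterate_one] at h2
    simp only [h2, Prod.snd_add, add_sub_add_right_eq_sub] at h1
    exact h1
  · simp only [Prod.snd_add]; push_cast; linarith [Int.floor_le z.2]
  · simp only [Prod.snd_add]; push_cast; linarith [Int.lt_floor_add_one z.2]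

theorem neg_side (φ : Cyl ≃ₜ Cyl) (hT : ∀ z : Cyl, φ (z + (0, 1)) = φ z + (0, 1))
    (hzero : (0:ℝ) ∈ rotSet φ) : (BN φ).Nonempty := by
  set ψ : Cyl ≃ₜ Cyl := ((Homeomorph.neg Cyl).trans φ).trans (Homeomorph.neg Cyl) with hψ
  have hψa : ∀ z, ψ z = - φ (-z) := fun z => rfl
  have hit : ∀ n z, ψ^[n] z = - φ^[n] (-z) := by
    intro n
    induction n with
    | zero => intro z; simp
    | succ n ih => intro z; rw [Function.iterate_succ_apply, ih, hψa, neg_neg]; rfl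
  have hTψ : ∀ z : Cyl, ψ (z + (0, 1)) = ψ z + (0, 1) := by
    intro z
    have := hT (-(z + (0, 1)))
    rw [show -(z + (0, 1)) + ((0, 1) : Cyl) = -z by abel] at this
    rw [hψa, hψa, this]; abel
  have hz : (0:ℝ) ∈ rotSet ψ := by
    refine mem_iInter.2 fun i => ?_
    have h1 := mem_iInter.1 hzero i
    have h2 := image_closure_subset_closure_image (continuous_neg (G := ℝ)) (mem_image_of_mem _ h1)
    rw [neg_zero] at h2
    refine closure_mono ?_ h2
    rintro _ ⟨r, hr, rfl⟩
    simp only [mem_iUnion] at hr ⊢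
    obtain ⟨N, hN, z, rfl⟩ := hr
    refine ⟨N, hN, -z, ?_⟩
    rw [hit, neg_neg, Prod.snd_neg, Prod.snd_neg]
    ring
  obtain ⟨M, hM⟩ := exists_bound ψ hTψ
  obtain ⟨z, hz1, hz2⟩ := core ψ hM hTψ hz
  have hpre : Neg.neg '' (Bminus ψ) = Bplus φ := by
    ext w
    simp only [image_neg_eq_neg, Set.mem_neg, Bminus, Bplus, mem_setOf_eq, hit, neg_neg,
      Prod.snd_neg, Left.neg_nonpos_iff]
  refine ⟨-z, hpre ▸ mem_image_of_mem _ hz1, ?_⟩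
  rintro ⟨K, hK⟩
  apply hz2
  refine ⟨K, fun w hw => ?_⟩
  have h1 := (Homeomorph.neg Cyl).image_connectedComponentIn hz1
  have h2 : -w ∈ connectedComponentIn (Bplus φ) (-z) := by
    rw [← hpre]
    exact h1 ▸ mem_image_of_mem _ hw
  have := hK _ h2
  rwa [Prod.snd_neg, abs_neg] at this

/-- If `0 ∈ ρ_V(f̂)`, then both `B⁻` and `B⁺` have an unbounded
connected component, i.e. `B_S⁻` and `B_N⁺` are nonempty. -/
theorem BS_BN_nonempty_of_zero_in_rotSet
    (L : DehnLift) (fhat : Cyl → Cyl)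
    (hfhat : ∀ z : ℝ × ℝ, projCyl (L.F z) = fhat (projCyl z))
    (hzero : (0:ℝ) ∈ rotSet fhat) :
    (BS fhat).Nonempty ∧ (BN fhat).Nonempty := by
  have hT := comm_T L fhat hfhat
  obtain ⟨φ, rfl⟩ := exists_homeo L fhat hfhat
  obtain ⟨M, hM⟩ := exists_bound φ hT
  exact ⟨core φ hM hT hzero, neg_side φ hT hzero⟩
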